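/- Let f₁: [0,a*] → ℝ (a* > 0) be a convex (downwards), strictly increasing, smooth function with f₁(0) = f₁'(0) = 0, whose graph Γ₁ contains straight line segments; let 𝓜 denote the set of all maximal straight line segments contained in Γ₁ (maximal in the sense that any segment of Γ₁ containing an element of 𝓜 coincides with it), and assume that the union of 𝓜 is dense in Γ₁ and that the points (0,0) and (a*, f₁(a*)) are limit points of the set of left endpoints of segments from 𝓜. Then for every ε > 0 there exists a convex (downwards), strictly increasing, smooth function f₂: [0,a*] → ℝ, different from f₁, with the following properties: ‖f₂ − f₁‖_{C([0,a*])} ≤ ε, f₂(0) = f₂'(0) = 0, f₂(a*) = f₁(a*), f₂'(a*) = f₁'(a*), and the mapping F: Γ₁ → Γ₂ between the graphs Γ₁ of f₁ and Γ₂ of f₂ given by F(x,y) = (φ⁻¹(x), f₂(φ⁻¹(f₁⁻¹(y)))), where φ: [0,a*] → [0,a*] is the diffeomorphic solution of the functional equation ∫₀^{φ(x)} (1 + [f₁'(t)]²)^{1/2} dt = ∫₀ˣ (1 + [f₂'(t)]²)^{1/2} dt for 0 ≤ x ≤ a*, is an isometry with respect to the intrinsic metrics of the curves Γ₁ and Γ₂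 and transforms each straight line segment of Γ₁ onto a straight line segment of Γ₂ of the same length. -/

import Mathlib

open Set Filter Metric Topology ENNReal

noncomputable section

/-- The point `(x, y)` of the Euclidean plane. -/
def ptE (x y : ℝ) : EuclideanSpace ℝ (Fin 2) :=
  (WithLp.equiv 2 (Fin 2 → ℝ)).symm ![x, y]

/-- The graph `Γ = {(x, f x) : x ∈ [0, A]}` of `f` over `[0, A]`. -/
def graphSet (f : ℝ → ℝ) (A : ℝ) : Set (EuclideanSpace ℝ (Fin 2)) :=
  (fun x => ptE x (f x)) '' Icc 0 A

/-- `[p, q]` is a maximal straight line segment contained in `Γ`: any segment of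
`Γ` containing it coincides with it. -/
def IsMaximalSegmentOf (Γ : Set (EuclideanSpace ℝ (Fin 2)))
    (p q : EuclideanSpace ℝ (Fin 2)) : Prop :=
  p ≠ q ∧ segment ℝ p q ⊆ Γ ∧
  ∀ p' q' : EuclideanSpace ℝ (Fin 2), segment ℝ p' q' ⊆ Γ →
    segment ℝ p q ⊆ segment ℝ p' q' → segment ℝ p' q' = segment ℝ p q

/-- The union of all maximal straight line segments of `Γ`. -/
def maxSegUnion (Γ : Set (EuclideanSpace ℝ (Fin 2))) :
    Set (EuclideanSpace ℝ (Fin 2)) :=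
  {z | ∃ p q, IsMaximalSegmentOf Γ p q ∧ z ∈ segment ℝ p q}

/-- The set of left endpoints of the maximal straight line segments of `Γ`. -/
def leftEndpoints (Γ : Set (EuclideanSpace ℝ (Fin 2))) :
    Set (EuclideanSpace ℝ (Fin 2)) :=
  {p | ∃ q, IsMaximalSegmentOf Γ p q ∧ p 0 < q 0}

/-- The intrinsic distance inside a set `S`: the infimum of lengths of
(continuous) paths joining `a` and `b` inside `S`. -/
def intrinsicDist (S : Set (EuclideanSpace ℝ (Fin 2)))
    (a b : EuclideanSpace ℝ (Fin 2)) : ℝ≥0∞ :=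
  ⨅ (γ : ℝ → EuclideanSpace ℝ (Fin 2)) (_ : ContinuousOn γ (Icc (0:ℝ) 1))
    (_ : γ 0 = a) (_ : γ 1 = b) (_ : ∀ t ∈ Icc (0:ℝ) 1, γ t ∈ S),
    eVariationOn γ (Icc 0 1)

lemma ptE_zero (x y : ℝ) : ptE x y 0 = x := rfl

lemma ptE_one (x y : ℝ) : ptE x y 1 = y := rfl

lemma dist_ptE (x y x' y' : ℝ) :
    dist (ptE x y) (ptE x' y') = √((x - x') ^ 2 + (y - y') ^ 2) := by
  simp [EuclideanSpace.dist_eq, Fin.sum_univ_two, Real.dist_eq, ptE_zero, ptE_one]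

lemma continuous_ptE {f : ℝ → ℝ} (hf : Continuous f) : Continuous fun x => ptE x (f x) := by
  unfold ptE
  simp only [WithLp.equiv_symm_apply]
  refine (PiLp.continuous_toLp 2 _).comp (continuous_pi fun i => ?_)
  fin_cases i <;> simp <;> fun_prop

/-- The length of the arc over `[0, x]` of a graph with slope function `G`. -/
def arcLength (G : ℝ → ℝ) (x : ℝ) : ℝ := ∫ t in (0:ℝ)..x, √(1 + G t ^ 2)

lemma continuous_speed {G : ℝ → ℝ} (hG : Continuous G) :
    Continuous fun t => √(1 + G t ^ 2) := by fun_prop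

lemma one_le_speed (u : ℝ) : 1 ≤ √(1 + u ^ 2) := by
  rw [Real.one_le_sqrt]; nlinarith [sq_nonneg u]

lemma hasDerivAt_arcLength {G : ℝ → ℝ} (hG : Continuous G) (x : ℝ) :
    HasDerivAt (arcLength G) (√(1 + G x ^ 2)) x :=
  intervalIntegral.integral_hasDerivAt_right ((continuous_speed hG).intervalIntegrable _ _)
    ((continuous_speed hG).stronglyMeasurableAtFilter _ _) (continuous_speed hG).continuousAt

lemma strictMono_arcLength {G : ℝ → ℝ} (hG : Continuous G) : StrictMono (arcLength G) :=
  strictMono_of_deriv_pos fun x => by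
    rw [(hasDerivAt_arcLength hG x).deriv]
    linarith [one_le_speed (G x)]

lemma dist_graph_le_arcLength {f G : ℝ → ℝ} (hf : ∀ x, HasDerivAt f (G x) x)
    (hG : Continuous G) (x y : ℝ) :
    dist (ptE x (f x)) (ptE y (f y)) ≤ |arcLength G y - arcLength G x| := by
  wlog hxy : x ≤ y generalizing x y
  · rw [dist_comm, abs_sub_comm]
    exact this y x (le_of_not_ge hxy)
  rcases hxy.eq_or_lt with rfl | hlt
  · simp
  rw [dist_comm, dist_ptE]
  set D := √((y - x) ^ 2 + (f y - f x) ^ 2) with hD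
  have hD2 : D ^ 2 = (y - x) ^ 2 + (f y - f x) ^ 2 := Real.sq_sqrt (by positivity)
  have hD0 : 0 < D := Real.sqrt_pos.2 (by nlinarith [sq_nonneg (f y - f x), sub_pos.2 hlt])
  have hder : ∀ t, HasDerivAt
      (fun t => D * arcLength G t - ((y - x) * t + (f y - f x) * f t))
      (D * √(1 + G t ^ 2) - ((y - x) * 1 + (f y - f x) * G t)) t := fun t =>
    ((hasDerivAt_arcLength hG t).const_mul _).sub
      (((hasDerivAt_id' t).const_mul _).add ((hf t).const_mul _))
  have hmono := monotone_of_deriv_nonneg (fun t => (hder t).differentiableAt) (fun t => by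
    rw [(hder t).deriv, sub_nonneg]
    refine (le_abs_self _).trans (abs_le_of_sq_le_sq ?_ (by positivity))
    rw [mul_pow, hD2, Real.sq_sqrt (by positivity)]
    nlinarith [sq_nonneg ((y - x) * G t - (f y - f x))])
  have h := hmono hxy
  have h' : D * D ≤ D * (arcLength G y - arcLength G x) := by simp only at h; nlinarith
  exact (le_of_mul_le_mul_left h' hD0).trans (le_abs_self _)

lemma exists_arcLength_le_mul_dist {f G : ℝ → ℝ} (hf : ∀ x, HasDerivAt f (G x) x)
    (hG : Continuous G) (A : ℝ) {ε : ℝ} (hε : 0 < ε) :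
    ∃ δ > 0, ∀ x ∈ Icc 0 A, ∀ y ∈ Icc 0 A, |x - y| < δ →
      |arcLength G y - arcLength G x| ≤ (1 + ε) * dist (ptE x (f x)) (ptE y (f y)) := by
  have huc := (isCompact_Icc (a := (0:ℝ)) (b := A)).uniformContinuousOn_of_continuous
    (continuous_speed hG).continuousOn
  obtain ⟨δ, hδ, h⟩ := Metric.uniformContinuousOn_iff.1 huc ε hε
  refine ⟨δ, hδ, fun x hx y hy hxy => ?_⟩
  wlog hle : x ≤ y generalizing x y
  · rw [dist_comm, abs_sub_comm]
    exact this y hy x hx (by rwa [abs_sub_comm]) (le_of_not_ge hle)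
  rcases hle.eq_or_lt with rfl | hlt
  · simp
  obtain ⟨s, hs, hs'⟩ := exists_hasDerivAt_eq_slope (arcLength G) _ hlt
    (fun t _ => (hasDerivAt_arcLength hG t).continuousAt.continuousWithinAt)
    (fun t _ => hasDerivAt_arcLength hG t)
  obtain ⟨u, hu, hu'⟩ := exists_hasDerivAt_eq_slope f G hlt
    (fun t _ => (hf t).continuousAt.continuousWithinAt) (fun t _ => hf t)
  have hpos : 0 < y - x := sub_pos.2 hlt
  rw [eq_div_iff hpos.ne'] at hs' hu'
  have hd : dist (ptE x (f x)) (ptE y (f y)) = √(1 + G u ^ 2) * (y - x) := by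
    rw [dist_comm, dist_ptE, ← hu', show (y - x) ^ 2 + (G u * (y - x)) ^ 2
      = (1 + G u ^ 2) * (y - x) ^ 2 by ring, Real.sqrt_mul (by positivity), Real.sqrt_sq hpos.le]
  rw [hd, ← hs', abs_of_nonneg (by positivity), ← mul_assoc]
  gcongr
  have hsu := h s ⟨hx.1.trans hs.1.le, hs.2.le.trans hy.2⟩ u
    ⟨hx.1.trans hu.1.le, hu.2.le.trans hy.2⟩ (by
      rw [Real.dist_eq, abs_lt]; rw [abs_lt] at hxy
      constructor <;> linarith [hs.1, hs.2, hu.1, hu.2])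
  rw [Real.dist_eq, abs_lt] at hsu
  nlinarith [one_le_speed (G u), hsu.2]

lemma eVariationOn_le_of_edist_le {E E' : Type*} [PseudoEMetricSpace E] [PseudoEMetricSpace E']
    {γ : ℝ → E} {u : ℝ → E'} {s : Set ℝ} (h : ∀ x y, edist (γ x) (γ y) ≤ edist (u x) (u y)) :
    eVariationOn γ s ≤ eVariationOn u s :=
  iSup_mono fun _ => Finset.sum_le_sum fun _ _ => h _ _

/-- The intrinsic distance on the graph of a `C¹` function is the length of the arc. -/
lemma intrinsicDist_graphSet {f G : ℝ → ℝ} (hf : ∀ x, HasDerivAt f (G x) x)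
    (hG : Continuous G) {A x y : ℝ} (hx : x ∈ Icc 0 A) (hy : y ∈ Icc 0 A) :
    intrinsicDist (graphSet f A) (ptE x (f x)) (ptE y (f y)) =
      ENNReal.ofReal |arcLength G y - arcLength G x| := by
  have hfc : Continuous f := continuous_iff_continuousAt.2 fun x => (hf x).continuousAt
  apply le_antisymm
  · have hmem : ∀ t ∈ Icc (0:ℝ) 1, x + t * (y - x) ∈ Icc 0 A := fun t ht => by
      have := (convex_Icc (0:ℝ) A).add_smul_sub_mem hx hy ht
      simpa using this
    refine iInf_le_of_le (fun t => ptE (x + t * (y - x)) (f (x + t * (y - x)))) <|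
      iInf_le_of_le ?_ <| iInf_le_of_le (by simp) <| iInf_le_of_le (by simp) <|
      iInf_le_of_le (fun t ht => ⟨_, hmem t ht, rfl⟩) ?_
    · exact ((continuous_ptE hfc).comp
        (by fun_prop : Continuous fun t : ℝ => x + t * (y - x))).continuousOn
    have key : ∀ v : ℝ → ℝ, (∀ s t, |v s - v t| = |arcLength G (x + s * (y - x)) -
        arcLength G (x + t * (y - x))|) → Monotone v →
        eVariationOn (fun t => ptE (x + t * (y - x)) (f (x + t * (y - x)))) (Icc 0 1) ≤
          ENNReal.ofReal |arcLength G y - arcLength G x| := by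
      intro v hv hm
      refine (eVariationOn_le_of_edist_le (u := v) fun s t => ?_).trans ?_
      · rw [edist_dist, edist_dist, Real.dist_eq, hv, abs_sub_comm]
        exact ENNReal.ofReal_le_ofReal (dist_graph_le_arcLength hf hG _ _)
      · have h1 := (hm.monotoneOn (Icc 0 1)).eVariationOn_eq (left_mem_Icc.2 zero_le_one)
          (right_mem_Icc.2 zero_le_one)
        rw [inter_self] at h1
        refine h1.le.trans (ENNReal.ofReal_le_ofReal ?_)
        have := hv 1 0
        simp only [one_mul, add_sub_cancel, zero_mul, add_zero] at this
        exact (le_abs_self _).trans this.le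
    have hS := (strictMono_arcLength hG).monotone
    rcases le_total x y with h | h
    · exact key (fun t => arcLength G (x + t * (y - x))) (fun s t => rfl) fun s t hst =>
        hS (by nlinarith [mul_le_mul_of_nonneg_right hst (sub_nonneg.2 h)])
    · exact key (fun t => -arcLength G (x + t * (y - x)))
        (fun s t => by rw [← abs_neg]; ring_nf) fun s t hst =>
        neg_le_neg (hS (by nlinarith [mul_le_mul_of_nonneg_right hst (sub_nonneg.2 h)]))
  · refine le_iInf fun γ => le_iInf fun hγ => le_iInf fun h0 => le_iInf fun h1 => le_iInf fun hS => ?_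
    rcases eq_or_ne (eVariationOn γ (Icc 0 1)) ⊤ with htop | htop
    · rw [htop]; exact le_top
    set V := (eVariationOn γ (Icc 0 1)).toReal with hV
    rw [← ENNReal.ofReal_toReal htop]
    apply ENNReal.ofReal_le_ofReal
    suffices H : ∀ ε > 0, |arcLength G y - arcLength G x| ≤ (1 + ε) * V by
      refine le_of_forall_pos_le_add fun η hη => ?_
      have hV0 : 0 ≤ V := ENNReal.toReal_nonneg
      have := H (η / (V + 1)) (by positivity)
      have h2 : η / (V + 1) * V ≤ η := by
        rw [div_mul_eq_mul_div, div_le_iff₀ (by positivity)]; nlinarith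
      linarith
    intro ε hε
    obtain ⟨δ, hδ, hloc⟩ := exists_arcLength_le_mul_dist hf hG A hε
    have hγeq : ∀ t ∈ Icc (0:ℝ) 1, γ t 0 ∈ Icc 0 A ∧ γ t = ptE (γ t 0) (f (γ t 0)) := by
      intro t ht
      obtain ⟨z, hz, hzt⟩ := hS t ht
      simp only at hzt
      rw [← hzt, ptE_zero]
      exact ⟨hz, rfl⟩
    obtain ⟨η, hη, hunif⟩ := Metric.uniformContinuousOn_iff.1
      (isCompact_Icc.uniformContinuousOn_of_continuous hγ) δ hδ
    obtain ⟨n, hn⟩ := exists_nat_one_div_lt hη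
    have hn0 : (0:ℝ) < n + 1 := by positivity
    set t : ℕ → ℝ := fun i => min 1 (i / (n + 1)) with ht
    have htm : Monotone t := fun i j hij => min_le_min le_rfl (by gcongr)
    have htI : ∀ i, t i ∈ Icc (0:ℝ) 1 := fun i => ⟨le_min zero_le_one (by positivity), min_le_left _ _⟩
    have hstep : ∀ i, dist (t i) (t (i + 1)) < η := fun i => by
      refine lt_of_le_of_lt ?_ hn
      rw [dist_comm, Real.dist_eq]
      refine (abs_min_sub_min_le_max _ _ _ _).trans ?_
      rw [sub_self, abs_zero, Nat.cast_succ, ← sub_div, add_sub_cancel_left, abs_of_pos (by positivity)]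
      exact max_le (by positivity) le_rfl
    have hsum := eVariationOn.sum_le (f := γ) (n := n + 1) htm htI
    have hreal : ∑ i ∈ Finset.range (n + 1), dist (γ (t i)) (γ (t (i + 1))) ≤ V := by
      rw [hV, ← ENNReal.ofReal_le_iff_le_toReal htop,
        ENNReal.ofReal_sum_of_nonneg fun _ _ => dist_nonneg]
      refine le_trans (le_of_eq (Finset.sum_congr rfl fun i _ => ?_)) hsum
      rw [edist_comm, edist_dist]
    have ht0 : γ (t 0) 0 = x := by simp [ht, h0, ptE_zero]
    have htn : γ (t (n + 1)) 0 = y := by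
      simp [ht, div_self hn0.ne', h1, ptE_zero]
    calc |arcLength G y - arcLength G x|
        = |∑ i ∈ Finset.range (n + 1),
            (arcLength G (γ (t (i + 1)) 0) - arcLength G (γ (t i) 0))| := by
          rw [Finset.sum_range_sub (fun i => arcLength G (γ (t i) 0)), htn, ht0]
      _ ≤ ∑ i ∈ Finset.range (n + 1),
            |arcLength G (γ (t (i + 1)) 0) - arcLength G (γ (t i) 0)| :=
          Finset.abs_sum_le_sum_abs _ _
      _ ≤ ∑ i ∈ Finset.range (n + 1), (1 + ε) * dist (γ (t i)) (γ (t (i + 1))) := by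
          refine Finset.sum_le_sum fun i _ => ?_
          obtain ⟨ha, ha'⟩ := hγeq _ (htI i)
          obtain ⟨hb, hb'⟩ := hγeq _ (htI (i + 1))
          have hcl : |γ (t i) 0 - γ (t (i + 1)) 0| < δ := by
            refine lt_of_le_of_lt ?_ (hunif _ (htI i) _ (htI (i + 1)) (hstep i))
            rw [dist_eq_norm]
            exact PiLp.norm_apply_le (γ (t i) - γ (t (i + 1))) 0
          have := hloc _ ha _ hb hcl
          rwa [← ha', ← hb'] at this
      _ ≤ (1 + ε) * V := by rw [← Finset.mul_sum]; gcongr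

section Perturbation

open Real

/-- The tent function of height `c / 2` supported on `[a, a + c]`. -/
def tent (c a s : ℝ) : ℝ := max 0 (min (s - a) (a + c - s))

lemma tent_nonneg (c a s : ℝ) : 0 ≤ tent c a s := le_max_left _ _

lemma continuous_tent (c a : ℝ) : Continuous (tent c a) := by unfold tent; fun_prop

lemma tent_of_le {c a s : ℝ} (h : s ≤ a) : tent c a s = 0 :=
  max_eq_left ((min_le_left _ _).trans (by linarith))

lemma tent_of_ge {c a s : ℝ} (h : a + c ≤ s) : tent c a s = 0 :=
  max_eq_left ((min_le_right _ _).trans (by linarith))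

lemma tent_pos {c a s : ℝ} (h : a < s) (h' : s < a + c) : 0 < tent c a s :=
  lt_max_of_lt_right (lt_min (by linarith) (by linarith))

lemma tent_le {c : ℝ} (hc : 0 ≤ c) (a s : ℝ) : tent c a s ≤ c := by
  refine max_le hc ?_
  rcases le_total s (a + c) with h | h
  · exact (min_le_left _ _).trans (by linarith)
  · exact (min_le_right _ _).trans (by linarith)

lemma abs_tent_sub_le (c a s t : ℝ) : |tent c a s - tent c a t| ≤ |s - t| := by
  refine (abs_max_sub_max_le_max _ _ _ _).trans (max_le (by simp) ?_)
  refine (abs_min_sub_min_le_max _ _ _ _).trans (max_le (by simp) ?_)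
  rw [← abs_neg]; ring_nf; rfl

/-- A combination of three tent functions with disjoint supports. -/
def tentSum (c : ℝ) (τ : ℝ × ℝ × ℝ) (s : ℝ) : ℝ :=
  τ.1 * tent c 0 s + τ.2.1 * tent c c s + τ.2.2 * tent c (2 * c) s

lemma continuous_tentSum (c : ℝ) (τ : ℝ × ℝ × ℝ) : Continuous (tentSum c τ) := by
  have := continuous_tent c
  unfold tentSum
  fun_prop

lemma tentSum_sub (c : ℝ) (τ σ : ℝ × ℝ × ℝ) (s : ℝ) :
    tentSum c τ s - tentSum c σ s = tentSum c (τ - σ) s := by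
  simp only [tentSum, Prod.fst_sub, Prod.snd_sub]; ring

lemma abs_triple_le {r : ℝ} (τ : ℝ × ℝ × ℝ) {x y z : ℝ} (hx : |x| ≤ r) (hy : |y| ≤ r)
    (hz : |z| ≤ r) : |τ.1 * x + τ.2.1 * y + τ.2.2 * z| ≤ 3 * r * ‖τ‖ := by
  have h1 : |τ.1| ≤ ‖τ‖ := norm_fst_le τ
  have h2 : |τ.2.1| ≤ ‖τ‖ := (norm_fst_le τ.2).trans (norm_snd_le τ)
  have h3 : |τ.2.2| ≤ ‖τ‖ := (norm_snd_le τ.2).trans (norm_snd_le τ)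
  calc |τ.1 * x + τ.2.1 * y + τ.2.2 * z| ≤ |τ.1| * |x| + |τ.2.1| * |y| + |τ.2.2| * |z| := by
        simpa only [abs_mul] using abs_add_three (τ.1 * x) (τ.2.1 * y) (τ.2.2 * z)
    _ ≤ ‖τ‖ * r + ‖τ‖ * r + ‖τ‖ * r := by gcongr
    _ = 3 * r * ‖τ‖ := by ring

lemma abs_tentSum_le {c : ℝ} (hc : 0 ≤ c) (τ : ℝ × ℝ × ℝ) (s : ℝ) :
    |tentSum c τ s| ≤ 3 * c * ‖τ‖ := by
  have h : ∀ a, |tent c a s| ≤ c := fun a => by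
    rw [abs_of_nonneg (tent_nonneg _ _ _)]; exact tent_le hc _ _
  exact abs_triple_le τ (h _) (h _) (h _)

lemma abs_tentSum_sub_le (c : ℝ) (τ : ℝ × ℝ × ℝ) (s t : ℝ) :
    |tentSum c τ s - tentSum c τ t| ≤ 3 * |s - t| * ‖τ‖ := by
  have h : tentSum c τ s - tentSum c τ t = τ.1 * (tent c 0 s - tent c 0 t) +
      τ.2.1 * (tent c c s - tent c c t) + τ.2.2 * (tent c (2 * c) s - tent c (2 * c) t) := by
    simp only [tentSum]; ring
  rw [h]
  exact abs_triple_le τ (abs_tent_sub_le _ _ _ _) (abs_tent_sub_le _ _ _ _)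
    (abs_tent_sub_le _ _ _ _)

lemma abs_cos_linearization_le (α : ℝ) {x y η : ℝ} (hx : |x| ≤ η) (hy : |y| ≤ η) :
    |cos (α + x) - cos (α + y) + sin α * (x - y)| ≤ η * |x - y| := by
  have hder : ∀ z, HasDerivAt (fun z => cos (α + z) + sin α * z) (-sin (α + z) + sin α) z :=
    fun z => by
      simpa using ((hasDerivAt_id' z).const_add α).cos.fun_add ((hasDerivAt_id' z).const_mul (sin α))
  have hb : ∀ z ∈ Icc (-η) η, ‖-sin (α + z) + sin α‖ ≤ η := fun z hz => by
    rw [neg_add_eq_sub, ← dist_eq_norm]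
    have := Real.abs_sin_sub_sin_le α (α + z)
    rw [Real.dist_eq]
    refine this.trans ?_
    rw [sub_add_cancel_left, abs_neg]
    exact abs_le.2 hz
  have := (convex_Icc (-η) η).norm_image_sub_le_of_norm_hasDerivWithin_le
    (fun z _ => (hder z).hasDerivWithinAt) hb (abs_le.1 hy) (abs_le.1 hx)
  simp only [Real.norm_eq_abs] at this
  convert this using 2
  ring

/-- The derivative of the map of `hasStrictFDerivAt_integral_cos`. -/
def weightedTents (A c κ : ℝ) (w θ : ℝ → ℝ) : (ℝ × ℝ × ℝ) →L[ℝ] ℝ :=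
  LinearMap.toContinuousLinearMap
    { toFun := fun τ => τ.1 * (∫ x in (0:ℝ)..A, w x * -sin (θ x - κ) * tent c 0 (θ x)) +
        τ.2.1 * (∫ x in (0:ℝ)..A, w x * -sin (θ x - κ) * tent c c (θ x)) +
        τ.2.2 * (∫ x in (0:ℝ)..A, w x * -sin (θ x - κ) * tent c (2 * c) (θ x))
      map_add' := fun σ τ => by simp only [Prod.fst_add, Prod.snd_add]; ring
      map_smul' := fun k τ => by
        simp only [Prod.smul_fst, Prod.smul_snd, smul_eq_mul, RingHom.id_apply]; ring }

lemma weightedTents_apply (A c κ : ℝ) (w θ : ℝ → ℝ) (τ : ℝ × ℝ × ℝ) :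
    weightedTents A c κ w θ τ =
      τ.1 * (∫ x in (0:ℝ)..A, w x * -sin (θ x - κ) * tent c 0 (θ x)) +
        τ.2.1 * (∫ x in (0:ℝ)..A, w x * -sin (θ x - κ) * tent c c (θ x)) +
        τ.2.2 * (∫ x in (0:ℝ)..A, w x * -sin (θ x - κ) * tent c (2 * c) (θ x)) := rfl

lemma weightedTents_eq_integral (A c κ : ℝ) {w θ : ℝ → ℝ} (hw : Continuous w)
    (hθ : Continuous θ) (τ : ℝ × ℝ × ℝ) :
    weightedTents A c κ w θ τ =
      ∫ x in (0:ℝ)..A, w x * -sin (θ x - κ) * tentSum c τ (θ x) := by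
  have ht := continuous_tent c
  have hi : ∀ k a, IntervalIntegrable (fun x => k * (w x * -sin (θ x - κ) * tent c a (θ x)))
      MeasureTheory.volume 0 A := fun k a => by
    refine Continuous.intervalIntegrable ?_ _ _
    have := (ht a).comp hθ
    fun_prop
  rw [weightedTents_apply, ← intervalIntegral.integral_const_mul,
    ← intervalIntegral.integral_const_mul, ← intervalIntegral.integral_const_mul,
    ← intervalIntegral.integral_add (hi _ _) (hi _ _),
    ← intervalIntegral.integral_add ((hi _ _).add (hi _ _)) (hi _ _)]
  refine intervalIntegral.integral_congr fun x _ => ?_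
  simp only [tentSum]; ring

lemma hasStrictFDerivAt_integral_cos {A c : ℝ} (hc : 0 ≤ c) (κ : ℝ) {w θ : ℝ → ℝ}
    (hw : Continuous w) (hθ : Continuous θ) :
    HasStrictFDerivAt
      (fun τ : ℝ × ℝ × ℝ => ∫ x in (0:ℝ)..A, w x * cos (θ x + tentSum c τ (θ x) - κ))
      (weightedTents A c κ w θ) 0 := by
  obtain ⟨W, hW⟩ := (isCompact_uIcc (a := (0:ℝ)) (b := A)).exists_bound_of_continuousOn
    hw.continuousOn
  have hW0 : 0 ≤ W := (norm_nonneg _).trans (hW 0 left_mem_uIcc)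
  refine HasStrictFDerivAt.of_isLittleO (Asymptotics.isLittleO_iff.2 fun ε hε => ?_)
  set K := W * (3 * c) * (3 * c) * |A - 0| with hK
  have hK0 : 0 ≤ K := by positivity
  have hr : 0 < ε / (K + 1) := by positivity
  filter_upwards [Metric.ball_mem_nhds ((0 : ℝ × ℝ × ℝ), (0 : ℝ × ℝ × ℝ)) hr] with p hp
  rw [Metric.mem_ball, Prod.dist_eq, max_lt_iff, dist_zero_right, dist_zero_right] at hp
  obtain ⟨σ, τ⟩ := p
  simp only at hp ⊢
  set r := ε / (K + 1) with hr'
  have hcs := continuous_tentSum c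
  have hcσ := (hcs σ).comp hθ
  have hcτ := (hcs τ).comp hθ
  have hcd := (hcs (σ - τ)).comp hθ
  simp only [Function.comp_def] at hcσ hcτ hcd
  rw [weightedTents_eq_integral A c κ hw hθ, ← intervalIntegral.integral_sub
    (Continuous.intervalIntegrable (by fun_prop) _ _)
    (Continuous.intervalIntegrable (by fun_prop) _ _), ← intervalIntegral.integral_sub
    (Continuous.intervalIntegrable (by fun_prop) _ _)
    (Continuous.intervalIntegrable (by fun_prop) _ _)]
  have hbound : ∀ x ∈ uIoc 0 A, ‖w x * cos (θ x + tentSum c σ (θ x) - κ) -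
      w x * cos (θ x + tentSum c τ (θ x) - κ) -
      w x * -sin (θ x - κ) * tentSum c (σ - τ) (θ x)‖ ≤
      W * (3 * c * r * (3 * c * ‖σ - τ‖)) := fun x hx => by
    have hs : ∀ ρ : ℝ × ℝ × ℝ, ‖ρ‖ < r → |tentSum c ρ (θ x)| ≤ 3 * c * r := fun ρ hρ =>
      (abs_tentSum_le hc ρ _).trans (by gcongr)
    have h1 := abs_cos_linearization_le (θ x - κ) (hs σ hp.1) (hs τ hp.2)
    rw [tentSum_sub] at h1
    have h2 : w x * cos (θ x + tentSum c σ (θ x) - κ) -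
      w x * cos (θ x + tentSum c τ (θ x) - κ) -
      w x * -sin (θ x - κ) * tentSum c (σ - τ) (θ x) =
      w x * (cos (θ x - κ + tentSum c σ (θ x)) - cos (θ x - κ + tentSum c τ (θ x)) +
        sin (θ x - κ) * tentSum c (σ - τ) (θ x)) := by
      rw [sub_add_eq_add_sub, sub_add_eq_add_sub]; ring
    rw [h2, norm_mul]
    have := hW x (uIoc_subset_uIcc hx)
    gcongr
    exact h1.trans (by gcongr; exact abs_tentSum_le hc _ _)
  refine (intervalIntegral.norm_integral_le_of_norm_le_const hbound).trans ?_
  have h3 : W * (3 * c * r * (3 * c * ‖σ - τ‖)) * |A - 0| = K * r * ‖σ - τ‖ := by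
    rw [hK]; ring
  rw [h3]
  gcongr
  rw [hr', mul_div_assoc', div_le_iff₀ (by positivity)]
  nlinarith

lemma integral_mul_tent_pos {A c a : ℝ} (hA : 0 < A) (hc : 0 < c) {θ u : ℝ → ℝ}
    (hθ : Continuous θ) (hu : Continuous u) (hθ0 : θ 0 ≤ a) (hθA : a + c ≤ θ A)
    (hpos : ∀ x, a < θ x → θ x < a + c → 0 < u x) :
    0 < ∫ x in (0:ℝ)..A, u x * tent c a (θ x) := by
  have ht := (continuous_tent c a).comp hθ
  simp only [Function.comp_def] at ht
  obtain ⟨x, hx, hx'⟩ := intermediate_value_Icc hA.le hθ.continuousOn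
    (show a + c / 2 ∈ Icc (θ 0) (θ A) from ⟨by linarith, by linarith⟩)
  refine intervalIntegral.integral_pos hA (by fun_prop) (fun y _ => ?_) ⟨x, hx, ?_⟩
  · rcases le_or_gt (θ y) a with h | h
    · simp [tent_of_le h]
    rcases le_or_gt (a + c) (θ y) with h' | h'
    · simp [tent_of_ge h']
    exact (mul_pos (hpos y h h') (tent_pos h h')).le
  · have h1 : a < θ x := by linarith
    have h2 : θ x < a + c := by linarith
    exact mul_pos (hpos x h1 h2) (tent_pos h1 h2)

/-- A tangent angle function can be perturbed by a small nonzero function of the angle without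
moving the endpoint of the curve. -/
lemma exists_tentSum_integral_eq {A c : ℝ} (hA : 0 < A) (hc : 0 < c) (hc' : 3 * c < π / 2)
    {w θ : ℝ → ℝ} (hw : Continuous w) (hwpos : ∀ x, 0 < w x) (hθ : Continuous θ)
    (hθ0 : θ 0 = 0) (hθA : θ A = 3 * c) {δ : ℝ} (hδ : 0 < δ) :
    ∃ τ : ℝ × ℝ × ℝ, ‖τ‖ < δ ∧ τ.2.2 ≠ 0 ∧
      (∫ x in (0:ℝ)..A, w x * cos (θ x + tentSum c τ (θ x))) = ∫ x in (0:ℝ)..A, w x * cos (θ x) ∧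
      (∫ x in (0:ℝ)..A, w x * sin (θ x + tentSum c τ (θ x))) =
        ∫ x in (0:ℝ)..A, w x * sin (θ x) := by
  set P : ℝ × ℝ × ℝ → ℝ := fun τ =>
    ∫ x in (0:ℝ)..A, w x * cos (θ x + tentSum c τ (θ x) - 0) with hP
  set Q : ℝ × ℝ × ℝ → ℝ := fun τ =>
    ∫ x in (0:ℝ)..A, w x * cos (θ x + tentSum c τ (θ x) - π / 2) with hQ
  set R : (ℝ × ℝ × ℝ) →L[ℝ] ℝ :=
    (ContinuousLinearMap.snd ℝ ℝ ℝ).comp (ContinuousLinearMap.snd ℝ ℝ (ℝ × ℝ)) with hR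
  have hstrict : HasStrictFDerivAt (fun τ => (P τ, Q τ, R τ))
      ((weightedTents A c 0 w θ).prod ((weightedTents A c (π / 2) w θ).prod R)) 0 :=
    (hasStrictFDerivAt_integral_cos hc.le 0 hw hθ).prodMk
      ((hasStrictFDerivAt_integral_cos hc.le (π / 2) hw hθ).prodMk R.hasStrictFDerivAt)
  have hcp : ∀ x, 0 < θ x → θ x < 3 * c → 0 < cos (θ x) := fun x h h' =>
    cos_pos_of_mem_Ioo ⟨by linarith [pi_pos], by linarith⟩
  have hint : ∀ (a : ℝ) (k : ℝ → ℝ), Continuous k → IntervalIntegrable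
      (fun x => w x * k (θ x) * tent c a (θ x)) MeasureTheory.volume 0 A := fun a k hk => by
    have := (continuous_tent c a).comp hθ
    refine Continuous.intervalIntegrable ?_ _ _
    fun_prop
  set c₁ := ∫ x in (0:ℝ)..A, w x * cos (θ x) * tent c 0 (θ x) with hc₁
  set s₁ := ∫ x in (0:ℝ)..A, w x * sin (θ x) * tent c 0 (θ x) with hs₁
  set c₂ := ∫ x in (0:ℝ)..A, w x * cos (θ x) * tent c c (θ x) with hc₂
  set s₂ := ∫ x in (0:ℝ)..A, w x * sin (θ x) * tent c c (θ x) with hs₂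
  have hc₁0 : 0 < c₁ := integral_mul_tent_pos hA hc hθ (by fun_prop) hθ0.le (by linarith)
    fun x h h' => mul_pos (hwpos x) (hcp x h (by linarith))
  have hc₂0 : 0 < c₂ := integral_mul_tent_pos hA hc hθ (by fun_prop) (by linarith) (by linarith)
    fun x h h' => mul_pos (hwpos x) (hcp x (by linarith) (by linarith))
  have h₁ : 0 < sin c * c₁ - cos c * s₁ := by
    have : 0 < ∫ x in (0:ℝ)..A, w x * sin (c - θ x) * tent c 0 (θ x) :=
      integral_mul_tent_pos hA hc hθ (by fun_prop) hθ0.le (by linarith) fun x h h' =>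
        mul_pos (hwpos x) (sin_pos_of_pos_of_lt_pi (by linarith) (by linarith [pi_pos]))
    convert this using 1
    rw [hc₁, hs₁, ← intervalIntegral.integral_const_mul, ← intervalIntegral.integral_const_mul,
      ← intervalIntegral.integral_sub ((hint _ _ continuous_cos).const_mul _)
        ((hint _ _ continuous_sin).const_mul _)]
    refine intervalIntegral.integral_congr fun x _ => ?_
    simp only [Real.sin_sub]; ring
  have h₂ : 0 < cos c * s₂ - sin c * c₂ := by
    have : 0 < ∫ x in (0:ℝ)..A, w x * sin (θ x - c) * tent c c (θ x) :=
      integral_mul_tent_pos hA hc hθ (by fun_prop) (by linarith) (by linarith) fun x h h' =>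
        mul_pos (hwpos x) (sin_pos_of_pos_of_lt_pi (by linarith) (by linarith [pi_pos]))
    convert this using 1
    rw [hc₂, hs₂, ← intervalIntegral.integral_const_mul, ← intervalIntegral.integral_const_mul,
      ← intervalIntegral.integral_sub ((hint _ _ continuous_sin).const_mul _)
        ((hint _ _ continuous_cos).const_mul _)]
    refine intervalIntegral.integral_congr fun x _ => ?_
    simp only [Real.sin_sub]; ring
  have hcc : 0 < cos c := cos_pos_of_mem_Ioo ⟨by linarith [pi_pos], by linarith⟩
  have hΔ : 0 < s₂ * c₁ - s₁ * c₂ := by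
    have : 0 < cos c * (s₂ * c₁ - s₁ * c₂) := by nlinarith [mul_pos h₁ hc₂0, mul_pos h₂ hc₁0]
    exact pos_of_mul_pos_right this hcc.le
  have hsurj : ((weightedTents A c 0 w θ).prod
      ((weightedTents A c (π / 2) w θ).prod R)).range = ⊤ := by
    refine LinearMap.range_eq_top.2 fun ⟨u, v, z⟩ => ?_
    set c₃ := ∫ x in (0:ℝ)..A, w x * cos (θ x) * tent c (2 * c) (θ x) with hc₃
    set s₃ := ∫ x in (0:ℝ)..A, w x * sin (θ x) * tent c (2 * c) (θ x) with hs₃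
    have e1 : ∀ τ, weightedTents A c 0 w θ τ = -(τ.1 * s₁ + τ.2.1 * s₂ + τ.2.2 * s₃) := fun τ => by
      rw [weightedTents_apply, hs₁, hs₂, hs₃]
      simp only [sub_zero, mul_neg, neg_mul, intervalIntegral.integral_neg]; ring
    have e2 : ∀ τ, weightedTents A c (π / 2) w θ τ = τ.1 * c₁ + τ.2.1 * c₂ + τ.2.2 * c₃ := fun τ => by
      rw [weightedTents_apply, hc₁, hc₂, hc₃]
      simp only [Real.sin_sub_pi_div_two, neg_neg]
    obtain ⟨D, hD⟩ : ∃ D, (s₂ * c₁ - s₁ * c₂) * D = 1 := ⟨_, mul_inv_cancel₀ hΔ.ne'⟩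
    refine ⟨(((u + z * s₃) * c₂ + (v - z * c₃) * s₂) * D,
      -((u + z * s₃) * c₁ + (v - z * c₃) * s₁) * D, z), ?_⟩
    simp only [ContinuousLinearMap.coe_coe, ContinuousLinearMap.prod_apply, e1, e2, hR,
      ContinuousLinearMap.comp_apply, ContinuousLinearMap.coe_snd', Prod.mk.injEq, and_true]
    constructor
    · linear_combination (u + z * s₃) * hD
    · linear_combination (v - z * c₃) * hD
  have hmap := hstrict.map_nhds_eq_of_surj hsurj
  have himage : (fun τ => (P τ, Q τ, R τ)) '' Metric.ball 0 δ ∈ 𝓝 (P 0, Q 0, R 0) := by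
    rw [← hmap]
    exact image_mem_map (Metric.ball_mem_nhds 0 hδ)
  have hev : ∀ᶠ z : ℝ in 𝓝[≠] 0, (P 0, Q 0, z) ∈
      (fun τ => (P τ, Q τ, R τ)) '' Metric.ball 0 δ := by
    refine Filter.Tendsto.eventually_mem (f := fun z : ℝ => (P 0, Q 0, z)) ?_ himage
    have : Continuous fun z : ℝ => (P 0, Q 0, z) := by fun_prop
    simpa using (this.tendsto 0).mono_left nhdsWithin_le_nhds
  obtain ⟨z, ⟨τ, hτ, hτz⟩, hz⟩ := (hev.and self_mem_nhdsWithin).exists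
  simp only [Prod.mk.injEq] at hτz
  have hzero : ∀ s, tentSum c 0 s = 0 := fun s => by simp [tentSum]
  refine ⟨τ, by simpa using hτ, ?_, ?_, ?_⟩
  · have : τ.2.2 = z := hτz.2.2
    rw [this]; exact hz
  · simpa [hP, hzero] using hτz.1
  · simpa [hQ, hzero, Real.cos_sub_pi_div_two] using hτz.2.1

lemma hasDerivAt_integral_of_continuous {u : ℝ → ℝ} (hu : Continuous u) (x : ℝ) :
    HasDerivAt (fun x => ∫ t in (0:ℝ)..x, u t) (u x) x :=
  intervalIntegral.integral_hasDerivAt_right (hu.intervalIntegrable _ _)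
    (hu.stronglyMeasurableAtFilter _ _) hu.continuousAt

lemma eq_add_mul_of_hasDerivAt_const {u : ℝ → ℝ} {k : ℝ} {s : Set ℝ} (hs : Convex ℝ s)
    (hu : ∀ x ∈ s, HasDerivAt u k x) {x y : ℝ} (hx : x ∈ s) (hy : y ∈ s) :
    u y = u x + k * (y - x) := by
  have h := hs.norm_image_sub_le_of_norm_hasDerivWithin_le (f := fun x => u x - k * x)
    (f' := fun _ => k - k * 1) (C := 0)
    (fun z hz => ((hu z hz).fun_sub ((hasDerivAt_id' z).const_mul k)).hasDerivWithinAt)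
    (fun z _ => by simp) hx hy
  rw [zero_mul, norm_le_zero_iff] at h
  linear_combination h

lemma surjective_of_hasDerivAt_ge {u u' : ℝ → ℝ} (hu : ∀ x, HasDerivAt u (u' x) x) {k : ℝ}
    (hk : 0 < k) (hge : ∀ x, k ≤ u' x) : Function.Surjective u := by
  have hm : Monotone fun x => u x - k * x := monotone_of_deriv_nonneg
    (fun x => ((hu x).fun_sub ((hasDerivAt_id' x).const_mul k)).differentiableAt) fun x => by
      rw [((hu x).fun_sub ((hasDerivAt_id' x).const_mul k)).deriv]
      linarith [hge x]
  refine Continuous.surjective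
    (continuous_iff_continuousAt.2 fun x => (hu x).continuousAt) ?_ ?_
  · refine tendsto_atTop_mono' _ ?_ (tendsto_atTop_add_const_left _ (u 0)
      (tendsto_id.const_mul_atTop hk))
    filter_upwards [eventually_ge_atTop 0] with x hx
    have := hm hx
    simp only [id] at this ⊢
    linarith
  · refine tendsto_atBot_mono' _ ?_ (tendsto_atBot_add_const_left _ (u 0)
      (tendsto_id.const_mul_atBot hk))
    filter_upwards [eventually_le_atBot 0] with x hx
    have := hm hx
    simp only [id] at this ⊢
    linarith

/-- A homeomorphic change of abscissa `X` carrying the graph of `f`, with slope function `G`, to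
the graph of `f₂`, with slope function `G₂`, so that arc lengths are preserved and the new slope
is a function `H` of the old one. -/
structure IsSlopeChange (f G f₂ G₂ H : ℝ → ℝ) (X : ℝ ≃ₜ ℝ) : Prop where
  hasDerivAt_left : ∀ x, HasDerivAt f (G x) x
  continuous_left : Continuous G
  hasDerivAt_right : ∀ x, HasDerivAt f₂ (G₂ x) x
  continuous_right : Continuous G₂
  slope : ∀ x, G₂ (X x) = H (G x)
  hasDerivAt : ∀ x, HasDerivAt X (√(1 + G x ^ 2) / √(1 + H (G x) ^ 2)) x

namespace IsSlopeChange

variable {f G f₂ G₂ H : ℝ → ℝ} {X : ℝ ≃ₜ ℝ}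

lemma contDiff (h : IsSlopeChange f G f₂ G₂ H X) : ContDiff ℝ 1 X := by
  refine contDiff_one_iff_deriv.2 ⟨fun x => (h.hasDerivAt x).differentiableAt, ?_⟩
  have : deriv X = fun x => √(1 + G x ^ 2) / √(1 + G₂ (X x) ^ 2) := funext fun x => by
    rw [(h.hasDerivAt x).deriv, h.slope]
  rw [this]
  have h1 := continuous_speed h.continuous_left
  have h2 := (continuous_speed h.continuous_right).comp X.continuous
  exact h1.div h2 fun x => (zero_lt_one.trans_le (one_le_speed _)).ne'

lemma contDiff_symm (h : IsSlopeChange f G f₂ G₂ H X) : ContDiff ℝ 1 X.symm :=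
  X.contDiff_symm_deriv (fun x => (div_pos (zero_lt_one.trans_le (one_le_speed _))
    (zero_lt_one.trans_le (one_le_speed _))).ne') h.hasDerivAt h.contDiff

lemma strictMono (h : IsSlopeChange f G f₂ G₂ H X) : StrictMono X :=
  strictMono_of_deriv_pos fun x => by
    rw [(h.hasDerivAt x).deriv]
    exact div_pos (zero_lt_one.trans_le (one_le_speed _)) (zero_lt_one.trans_le (one_le_speed _))

lemma mem_Icc_iff (h : IsSlopeChange f G f₂ G₂ H X) {A : ℝ} (h0 : X 0 = 0) (hA : X A = A)
    {x : ℝ} : X x ∈ Icc 0 A ↔ x ∈ Icc 0 A := by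
  have h1 := h.strictMono.le_iff_le (a := 0) (b := x)
  have h2 := h.strictMono.le_iff_le (a := x) (b := A)
  rw [h0] at h1
  rw [hA] at h2
  exact and_congr h1 h2

lemma hasDerivAt_comp (h : IsSlopeChange f G f₂ G₂ H X) (x : ℝ) :
    HasDerivAt (fun x => f₂ (X x)) (H (G x) * (√(1 + G x ^ 2) / √(1 + H (G x) ^ 2))) x :=
  ((h.hasDerivAt_right (X x)).comp x (h.hasDerivAt x)).congr_deriv (by rw [h.slope])

lemma arcLength_eq (h : IsSlopeChange f G f₂ G₂ H X) (h0 : X 0 = 0) (x : ℝ) :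
    arcLength G₂ (X x) = arcLength G x := by
  have hd : ∀ x ∈ univ, HasDerivAt (fun x => arcLength G₂ (X x) - arcLength G x) 0 x :=
    fun x _ => by
      refine (((hasDerivAt_arcLength h.continuous_right (X x)).comp x (h.hasDerivAt x)).fun_sub
        (hasDerivAt_arcLength h.continuous_left x)).congr_deriv ?_
      have : √(1 + H (G x) ^ 2) ≠ 0 := (zero_lt_one.trans_le (one_le_speed _)).ne'
      rw [h.slope, mul_div_cancel₀ _ this, sub_self]
  have := eq_add_mul_of_hasDerivAt_const convex_univ hd (mem_univ 0) (mem_univ x)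
  simp only [h0, arcLength, intervalIntegral.integral_same, sub_self, zero_mul, add_zero] at this
  exact sub_eq_zero.1 this

lemma exists_ne (h : IsSlopeChange f G f₂ G₂ H X) {A : ℝ} (hA : 0 < A) (h0 : X 0 = 0)
    (hXA : X A = A) (hne : ∃ x ∈ Icc 0 A, H (G x) ≠ G x) : ∃ x ∈ Icc 0 A, f₂ x ≠ f x := by
  by_contra! hcon
  obtain ⟨x, hx, hne⟩ := hne
  have hG : EqOn G₂ G (Icc 0 A) := fun y hy => by
    have hu := uniqueDiffOn_Icc hA y hy
    rw [← (h.hasDerivAt_right y).hasDerivWithinAt.derivWithin hu,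
      ← (h.hasDerivAt_left y).hasDerivWithinAt.derivWithin hu]
    exact derivWithin_congr hcon (hcon y hy)
  have hXx := (h.mem_Icc_iff h0 hXA).2 hx
  have hX : X x = x := by
    apply (strictMono_arcLength h.continuous_left).injective
    rw [← h.arcLength_eq h0 x]
    refine intervalIntegral.integral_congr fun t ht => ?_
    rw [uIcc_of_le hXx.1] at ht
    simp only [hG ⟨ht.1, ht.2.trans hXx.2⟩]
  apply hne
  rw [← h.slope, hX, hG hx]

/-- The map of graphs induced by a slope change. -/
def graphMap (f₂ : ℝ → ℝ) (X : ℝ → ℝ) (p : EuclideanSpace ℝ (Fin 2)) :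
    EuclideanSpace ℝ (Fin 2) := ptE (X (p 0)) (f₂ (X (p 0)))

lemma image_graphSet (h : IsSlopeChange f G f₂ G₂ H X) {A : ℝ} (h0 : X 0 = 0) (hA : X A = A) :
    graphMap f₂ X '' graphSet f A = graphSet f₂ A := by
  apply Subset.antisymm
  · rintro _ ⟨_, ⟨x, hx, rfl⟩, rfl⟩
    exact ⟨X x, (h.mem_Icc_iff h0 hA).2 hx, rfl⟩
  · rintro _ ⟨y, hy, rfl⟩
    rw [← X.apply_symm_apply y] at hy ⊢
    exact ⟨_, ⟨_, (h.mem_Icc_iff h0 hA).1 hy, rfl⟩, rfl⟩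

lemma intrinsicDist_eq (h : IsSlopeChange f G f₂ G₂ H X) {A : ℝ} (h0 : X 0 = 0) (hA : X A = A)
    {p q : EuclideanSpace ℝ (Fin 2)} (hp : p ∈ graphSet f A) (hq : q ∈ graphSet f A) :
    intrinsicDist (graphSet f A) p q =
      intrinsicDist (graphSet f₂ A) (graphMap f₂ X p) (graphMap f₂ X q) := by
  obtain ⟨x, hx, rfl⟩ := hp
  obtain ⟨y, hy, rfl⟩ := hq
  simp only [graphMap, ptE_zero]
  rw [intrinsicDist_graphSet h.hasDerivAt_left h.continuous_left hx hy,
    intrinsicDist_graphSet h.hasDerivAt_right h.continuous_right ((h.mem_Icc_iff h0 hA).2 hx)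
      ((h.mem_Icc_iff h0 hA).2 hy), h.arcLength_eq h0, h.arcLength_eq h0]

lemma image_segment (h : IsSlopeChange f G f₂ G₂ H X) {A : ℝ} {p q : EuclideanSpace ℝ (Fin 2)}
    (hpq : p ≠ q) (hseg : segment ℝ p q ⊆ graphSet f A) :
    graphMap f₂ X '' segment ℝ p q = segment ℝ (graphMap f₂ X p) (graphMap f₂ X q) ∧
      dist (graphMap f₂ X p) (graphMap f₂ X q) = dist p q := by
  obtain ⟨u, hu, rfl⟩ := hseg (left_mem_segment ℝ p q)
  obtain ⟨v, hv, rfl⟩ := hseg (right_mem_segment ℝ _ q)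
  simp only at hpq hseg ⊢
  have huv : u ≠ v := fun e => hpq (by rw [e])
  have hvu : v - u ≠ 0 := sub_ne_zero.2 huv.symm
  have hline : ∀ x y x' y' t : ℝ, AffineMap.lineMap (ptE x y) (ptE x' y') t =
      ptE (x + t * (x' - x)) (y + t * (y' - y)) := fun x y x' y' t => by
    ext i
    fin_cases i <;> simp [AffineMap.lineMap_apply, ptE] <;> ring
  rw [segment_eq_image_lineMap] at hseg
  set k := (f v - f u) / (v - u) with hk
  have hk' : f v - f u = k * (v - u) := by rw [hk, div_mul_cancel₀ _ hvu]
  have haff : EqOn f (fun x => f u + k * (x - u)) (uIcc u v) := fun x hx => by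
    rw [← segment_eq_uIcc, segment_eq_image_lineMap] at hx
    obtain ⟨t, ht, rfl⟩ := hx
    obtain ⟨z, _, hz⟩ := hseg ⟨t, ht, rfl⟩
    rw [hline] at hz
    have hz0 : z = u + t * (v - u) := congrArg (fun p : EuclideanSpace ℝ (Fin 2) => p 0) hz
    have hz1 : f z = f u + t * (f v - f u) :=
      congrArg (fun p : EuclideanSpace ℝ (Fin 2) => p 1) hz
    have hl : AffineMap.lineMap u v t = u + t * (v - u) := by
      simp [AffineMap.lineMap_apply]; ring
    rw [hl, ← hz0, hz1, hz0, hk']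
    ring
  have hconv : Convex ℝ (uIcc u v) := convex_uIcc u v
  have hG : ∀ x ∈ uIcc u v, G x = k := fun x hx => by
    have hun : UniqueDiffWithinAt ℝ (uIcc u v) x := by
      refine uniqueDiffOn_Icc ?_ x hx
      simpa using huv.symm
    rw [← (h.hasDerivAt_left x).hasDerivWithinAt.derivWithin hun, derivWithin_congr haff (haff hx)]
    have := (((hasDerivAt_id' x).sub_const u).const_mul k).const_add (f u)
    rw [mul_one] at this
    exact this.hasDerivWithinAt.derivWithin hun
  set l := √(1 + k ^ 2) / √(1 + H k ^ 2) with hl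
  have hX : ∀ x ∈ uIcc u v, X x = X u + l * (x - u) := fun x hx =>
    eq_add_mul_of_hasDerivAt_const hconv (fun y hy => by simpa only [hG y hy] using h.hasDerivAt y)
      left_mem_uIcc hx
  have hY : ∀ x ∈ uIcc u v, f₂ (X x) = f₂ (X u) + H k * l * (x - u) := fun x hx =>
    eq_add_mul_of_hasDerivAt_const (u := fun x => f₂ (X x)) hconv
      (fun y hy => by simpa only [hG y hy] using h.hasDerivAt_comp y) left_mem_uIcc hx
  have hXv := hX v right_mem_uIcc
  have hYv := hY v right_mem_uIcc
  constructor
  · rw [segment_eq_image_lineMap, segment_eq_image_lineMap, image_image]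
    refine image_congr fun t ht => ?_
    have ht' : u + t * (v - u) ∈ uIcc u v := by
      rw [← segment_eq_uIcc, segment_eq_image_lineMap]
      exact ⟨t, ht, by simp [AffineMap.lineMap_apply]; ring⟩
    rw [hline]
    simp only [graphMap, ptE_zero, hline]
    rw [hY _ ht', hX _ ht', hYv, hXv]
    congr 1 <;> ring
  · simp only [graphMap, ptE_zero, dist_ptE]
    congr 1
    rw [hYv, hXv]
    have hl2 : l ^ 2 * (1 + H k ^ 2) = 1 + k ^ 2 := by
      rw [hl, div_pow, Real.sq_sqrt (by positivity), Real.sq_sqrt (by positivity)]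
      field_simp
    linear_combination (v - u) ^ 2 * hl2 - (f v - f u + k * (v - u)) * hk'

end IsSlopeChange

lemma speed_mul_cos_arctan (u : ℝ) : √(1 + u ^ 2) * cos (arctan u) = 1 := by
  rw [cos_arctan]
  exact mul_one_div_cancel (zero_lt_one.trans_le (one_le_speed u)).ne'

lemma speed_mul_sin_arctan (u : ℝ) : √(1 + u ^ 2) * sin (arctan u) = u := by
  rw [sin_arctan]
  exact mul_div_cancel₀ _ (zero_lt_one.trans_le (one_le_speed u)).ne'

lemma tentSum_eq_zero {c s : ℝ} (hc : 0 ≤ c) (hs : s ≤ 0 ∨ 3 * c ≤ s) (τ : ℝ × ℝ × ℝ) :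
    tentSum c τ s = 0 := by
  unfold tentSum
  rcases hs with h | h
  · rw [tent_of_le h, tent_of_le (by linarith), tent_of_le (by linarith)]; ring
  · rw [tent_of_ge (by linarith), tent_of_ge (by linarith), tent_of_ge (by linarith)]; ring

lemma strictMono_add_tentSum (c : ℝ) {τ : ℝ × ℝ × ℝ} (hτ : 3 * ‖τ‖ < 1) :
    StrictMono fun s => s + tentSum c τ s := fun s t hst => by
  have h := neg_le_of_abs_le (abs_tentSum_sub_le c τ t s)
  rw [abs_of_pos (sub_pos.2 hst)] at h
  simp only
  nlinarith [sub_pos.2 hst]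

lemma abs_integral_speed_mul_sub_le {G u v : ℝ → ℝ} {A M r x : ℝ} (hG : Continuous G)
    (hu : Continuous u) (hv : Continuous v) (hGM : ∀ x, |G x| ≤ M)
    (huv : ∀ x, |u x - v x| ≤ r) (hx : x ∈ Icc 0 A) :
    |(∫ t in (0:ℝ)..x, √(1 + G t ^ 2) * u t) - ∫ t in (0:ℝ)..x, √(1 + G t ^ 2) * v t| ≤
      √(1 + M ^ 2) * r * A := by
  have hr : 0 ≤ r := (abs_nonneg _).trans (huv 0)
  rw [← intervalIntegral.integral_sub (Continuous.intervalIntegrable (by fun_prop) _ _)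
    (Continuous.intervalIntegrable (by fun_prop) _ _)]
  rw [← Real.norm_eq_abs]
  refine (intervalIntegral.norm_integral_le_of_norm_le_const (C := √(1 + M ^ 2) * r)
    fun t _ => ?_).trans ?_
  · rw [← mul_sub, norm_mul, Real.norm_of_nonneg (Real.sqrt_nonneg _)]
    have := sq_le_sq' (neg_le_of_abs_le (hGM t)) (le_of_abs_le (hGM t))
    gcongr
    exact huv t
  · rw [sub_zero, abs_of_nonneg hx.1]
    gcongr
    exact hx.2

lemma exists_isSlopeChange {A : ℝ} (hA : 0 < A) {f G : ℝ → ℝ} (hf : ∀ x, HasDerivAt f (G x) x)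
    (hf0 : f 0 = 0) (hG : Continuous G) (hmono : Monotone G) (hG0 : G 0 = 0)
    (hGpos : ∀ x, 0 < x → 0 < G x) (hG_nonneg : ∀ x, 0 ≤ G x) (hG_le : ∀ x, G x ≤ G A)
    {ε : ℝ} (hε : 0 < ε) :
    ∃ (f₂ G₂ H : ℝ → ℝ) (X : ℝ ≃ₜ ℝ), IsSlopeChange f G f₂ G₂ H X ∧ X 0 = 0 ∧ X A = A ∧
      f₂ 0 = 0 ∧ f₂ A = f A ∧ Monotone G₂ ∧ G₂ 0 = 0 ∧ G₂ A = G A ∧ (∀ x, 0 < x → 0 < G₂ x) ∧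
      (∀ x ∈ Icc 0 A, |f₂ x - f x| ≤ ε) ∧ ∃ x ∈ Icc 0 A, H (G x) ≠ G x := by
  set c := arctan (G A) / 3 with hc
  have hc0 : 0 < c := div_pos (arctan_pos.2 (hGpos A hA)) (by norm_num)
  have hc3 : 3 * c = arctan (G A) := by rw [hc]; ring
  have hcpi : 3 * c < π / 2 := hc3 ▸ arctan_lt_pi_div_two _
  set w : ℝ → ℝ := fun x => √(1 + G x ^ 2) with hw
  have hwc : Continuous w := continuous_speed hG
  have hw1 : ∀ x, 1 ≤ w x := fun x => one_le_speed _
  set θ : ℝ → ℝ := fun x => arctan (G x) with hθ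
  have hθc : Continuous θ := continuous_arctan.comp hG
  set M := √(1 + G A ^ 2) * A * (3 * c) * (1 + G A) with hM
  have hGA := hGpos A hA
  have hM0 : 0 < M := by positivity
  obtain ⟨τ, hτ, hτ3, hcos, hsin⟩ := exists_tentSum_integral_eq hA hc0 hcpi hwc
    (fun x => zero_lt_one.trans_le (hw1 x)) hθc (by simp [hθ, hG0]) hc3.symm
    (lt_min (by norm_num : (0:ℝ) < 1 / 3) (div_pos hε hM0))
  rw [lt_min_iff, lt_div_iff₀ hM0] at hτ
  set h : ℝ → ℝ := fun s => s + tentSum c τ s with hh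
  have hhc : Continuous h := continuous_id.add (continuous_tentSum c τ)
  have hhm : StrictMono h := strictMono_add_tentSum c (by linarith [hτ.1])
  have hh0 : h 0 = 0 := by simp [hh, tentSum_eq_zero hc0.le (Or.inl le_rfl)]
  have hh3 : h (3 * c) = 3 * c := by simp [hh, tentSum_eq_zero hc0.le (Or.inr le_rfl)]
  set β : ℝ → ℝ := fun x => h (θ x) with hβ
  have hβc : Continuous β := hhc.comp hθc
  have hβ0 : ∀ x, 0 ≤ β x := fun x => hh0 ▸ hhm.monotone (arctan_nonneg.2 (hG_nonneg x))
  have hβ3 : ∀ x, β x ≤ 3 * c := fun x =>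
    hh3 ▸ hhm.monotone (hc3 ▸ arctan_strictMono.monotone (hG_le x))
  have hβI : ∀ x, β x ∈ Ioo (-(π / 2)) (π / 2) := fun x =>
    ⟨by linarith [hβ0 x, pi_pos], (hβ3 x).trans_lt hcpi⟩
  have hβcos : ∀ x, 0 < cos (β x) := fun x => cos_pos_of_mem_Ioo (hβI x)
  have hβm : Monotone β := fun x y hxy => hhm.monotone (arctan_strictMono.monotone (hmono hxy))
  set X₀ : ℝ → ℝ := fun x => ∫ t in (0:ℝ)..x, w t * cos (β t) with hX₀
  set Y : ℝ → ℝ := fun x => ∫ t in (0:ℝ)..x, w t * sin (β t) with hY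
  have hX' : ∀ x, HasDerivAt X₀ (w x * cos (β x)) x :=
    hasDerivAt_integral_of_continuous (by fun_prop)
  have hY' : ∀ x, HasDerivAt Y (w x * sin (β x)) x :=
    hasDerivAt_integral_of_continuous (by fun_prop)
  have hpos : ∀ x, 0 < w x * cos (β x) := fun x =>
    mul_pos (zero_lt_one.trans_le (hw1 x)) (hβcos x)
  have hXm : StrictMono X₀ := strictMono_of_deriv_pos fun x => by rw [(hX' x).deriv]; exact hpos x
  have hXs : Function.Surjective X₀ := by
    refine surjective_of_hasDerivAt_ge hX'
      (cos_pos_of_mem_Ioo ⟨by linarith [pi_pos], hcpi⟩ : 0 < cos (3 * c)) fun x => ?_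
    have := cos_le_cos_of_nonneg_of_le_pi (hβ0 x) (by linarith [pi_pos]) (hβ3 x)
    nlinarith [hw1 x, hβcos x]
  set X : ℝ ≃ₜ ℝ := (hXm.orderIsoOfSurjective X₀ hXs).toHomeomorph with hX
  have hXX : ⇑X = X₀ := rfl
  have hX0 : X 0 = 0 := by simp [hXX, hX₀]
  have hid : ∀ x, ∫ t in (0:ℝ)..x, w t * cos (θ t) = x := fun x => by
    simp only [hw, hθ, speed_mul_cos_arctan]; simp
  have hfint : ∀ x, ∫ t in (0:ℝ)..x, w t * sin (θ t) = f x := fun x => by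
    simp only [hw, hθ, speed_mul_sin_arctan]
    rw [intervalIntegral.integral_eq_sub_of_hasDerivAt (fun y _ => hf y)
      (hG.intervalIntegrable _ _), hf0, sub_zero]
  have hXA : X A = A := hcos.trans (hid A)
  have hYA : Y A = f A := hsin.trans (hfint A)
  set f₂ : ℝ → ℝ := fun y => Y (X.symm y) with hf₂
  set G₂ : ℝ → ℝ := fun y => tan (β (X.symm y)) with hG₂
  have hsymm0 : X.symm 0 = 0 := by rw [X.symm_apply_eq, hX0]
  have hsymmA : X.symm A = A := by rw [X.symm_apply_eq, hXA]
  have hsymm_mono : StrictMono X.symm := (hXm.orderIsoOfSurjective X₀ hXs).symm.strictMono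
  have htan : ContinuousOn tan (Ioo (-(π / 2)) (π / 2)) := continuousOn_tan_Ioo
  have hchange : IsSlopeChange f G f₂ G₂ (fun u => tan (h (arctan u))) X := by
    refine ⟨hf, hG, fun y => ?_, ?_, fun x => ?_, fun x => ?_⟩
    · have hs : HasDerivAt X.symm (w (X.symm y) * cos (β (X.symm y)))⁻¹ y :=
        (hX' (X.symm y)).of_local_left_inverse X.symm.continuous.continuousAt (hpos _).ne'
          (Eventually.of_forall X.apply_symm_apply)
      refine ((hY' (X.symm y)).comp y hs).congr_deriv ?_
      have h1 := (hβcos (X.symm y)).ne'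
      have h2 := (zero_lt_one.trans_le (hw1 (X.symm y))).ne'
      simp only [hG₂, tan_eq_sin_div_cos]
      field_simp
    · exact htan.comp_continuous (hβc.comp X.symm.continuous) fun y => hβI _
    · simp only [hG₂, X.symm_apply_apply]; rfl
    · have := inv_sqrt_one_add_tan_sq (hβcos x)
      rw [div_eq_mul_inv]
      convert hX' x using 2
  refine ⟨f₂, G₂, _, X, hchange, hX0, hXA, ?_, ?_, ?_, ?_, ?_, ?_, ?_, ?_⟩
  · simp [hf₂, hsymm0, hY]
  · simp only [hf₂, hsymmA, hYA]
  · exact fun x y hxy => strictMonoOn_tan.monotoneOn (hβI _) (hβI _)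
      (hβm (hsymm_mono.monotone hxy))
  · simp [hG₂, hsymm0, hβ, hθ, hG0, hh0]
  · simp only [hG₂, hsymmA, hβ, hθ]
    rw [← hc3, hh3, hc3, tan_arctan]
  · intro x hx
    have h1 : 0 < X.symm x := hsymm0 ▸ hsymm_mono hx
    have h2 : 0 < β (X.symm x) := hh0 ▸ hhm (arctan_pos.2 (hGpos _ h1))
    exact tan_pos_of_pos_of_lt_pi_div_two h2 (hβI _).2
  · intro y hy
    obtain ⟨x, rfl⟩ := X.surjective y
    have hx := (hchange.mem_Icc_iff hX0 hXA).1 hy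
    have hGM : ∀ x, |G x| ≤ G A := fun x => by rw [abs_of_nonneg (hG_nonneg x)]; exact hG_le x
    have hβθ : ∀ x, |β x - θ x| ≤ 3 * c * ‖τ‖ := fun x => by
      simp only [hβ, hh, add_sub_cancel_left]; exact abs_tentSum_le hc0.le _ _
    have h1 := abs_integral_speed_mul_sub_le hG (continuous_cos.comp hβc)
      (continuous_cos.comp hθc) hGM
      (fun x => (Real.abs_cos_sub_cos_le (β x) (θ x)).trans (hβθ x)) hx
    have h2 := abs_integral_speed_mul_sub_le hG (continuous_sin.comp hβc)
      (continuous_sin.comp hθc) hGM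
      (fun x => (Real.abs_sin_sub_sin_le (β x) (θ x)).trans (hβθ x)) hx
    have h1' : |X x - x| ≤ √(1 + G A ^ 2) * (3 * c * ‖τ‖) * A := by
      have h : |X₀ x - ∫ t in (0:ℝ)..x, w t * cos (θ t)| ≤ _ := h1
      rwa [hid x] at h
    have h2' : |Y x - f x| ≤ √(1 + G A ^ 2) * (3 * c * ‖τ‖) * A := by
      rw [← hfint x]; exact h2
    have h3 : |f x - f (X x)| ≤ G A * |x - X x| :=
      convex_univ.norm_image_sub_le_of_norm_hasDerivWithin_le
        (fun y _ => (hf y).hasDerivWithinAt) (fun y _ => hGM y) (mem_univ _) (mem_univ _)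
    simp only [hf₂, X.symm_apply_apply]
    rw [abs_sub_comm x] at h3
    calc |Y x - f (X x)| ≤ |Y x - f x| + |f x - f (X x)| := abs_sub_le _ _ _
      _ ≤ √(1 + G A ^ 2) * (3 * c * ‖τ‖) * A + G A * (√(1 + G A ^ 2) * (3 * c * ‖τ‖) * A) := by
        refine add_le_add h2' (h3.trans ?_); gcongr
      _ = ‖τ‖ * M := by rw [hM]; ring
      _ ≤ ε := hτ.2.le
  · obtain ⟨x, hx, hx'⟩ := intermediate_value_Icc hA.le hθc.continuousOn
      (show 2 * c + c / 2 ∈ Icc (θ 0) (θ A) from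
        ⟨by simp only [hθ, hG0, arctan_zero]; positivity, by simp only [hθ]; linarith⟩)
    refine ⟨x, hx, fun heq => ?_⟩
    have h1 : h (θ x) = θ x := by
      have h2 := congrArg arctan heq
      rwa [arctan_tan (hβI x).1 (hβI x).2] at h2
    rw [hx'] at h1
    have h2 : 0 < tent c (2 * c) (2 * c + c / 2) := tent_pos (by linarith) (by linarith)
    simp only [hh, tentSum, add_eq_left] at h1
    rw [tent_of_ge (a := 0) (by linarith), tent_of_ge (a := c) (by linarith)] at h1
    simp only [mul_zero, zero_add, mul_eq_zero] at h1
    exact h1.elim hτ3 h2.ne'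

end Perturbation

lemma exists_slope_extension {A : ℝ} (hA : 0 < A) {f : ℝ → ℝ}
    (hconv : ConvexOn ℝ (Icc 0 A) f) (hmono : StrictMonoOn f (Icc 0 A))
    (hsm : ContDiffOn ℝ 1 f (Icc 0 A)) (h0' : derivWithin f (Icc 0 A) 0 = 0) :
    ∃ G : ℝ → ℝ, (∀ x ∈ Icc 0 A, HasDerivWithinAt f (G x) (Icc 0 A) x) ∧ Continuous G ∧
      Monotone G ∧ G 0 = 0 ∧ (∀ x, 0 < x → 0 < G x) ∧ (∀ x, 0 ≤ G x) ∧ ∀ x, G x ≤ G A := by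
  have h0A : (0:ℝ) ∈ Icc 0 A := left_mem_Icc.2 hA.le
  have hAA : A ∈ Icc 0 A := right_mem_Icc.2 hA.le
  have hdiff : DifferentiableOn ℝ f (Icc 0 A) := hsm.differentiableOn one_ne_zero
  set g := derivWithin f (Icc 0 A) with hg
  have hgm : MonotoneOn g (Icc 0 A) := hconv.monotoneOn_derivWithin hdiff
  have hgc : ContinuousOn g (Icc 0 A) := hsm.continuousOn_derivWithin (uniqueDiffOn_Icc hA) le_rfl
  set G := IccExtend hA.le ((Icc 0 A).domRestrict g) with hG
  have hGg : ∀ x ∈ Icc 0 A, G x = g x := fun x hx => IccExtend_of_mem hA.le _ hx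
  have hGm : Monotone G := Monotone.IccExtend _ fun x y hxy => hgm x.2 y.2 hxy
  have hG0 : G 0 = 0 := (hGg 0 h0A).trans h0'
  have hGproj : ∀ x, ∃ y ∈ Icc 0 A, G x = G y := fun x =>
    ⟨projIcc 0 A hA.le x, (projIcc 0 A hA.le x).2, by rw [hGg _ (projIcc 0 A hA.le x).2]; rfl⟩
  have hder : ∀ x ∈ Icc 0 A, HasDerivWithinAt f (G x) (Icc 0 A) x := fun x hx =>
    hGg x hx ▸ (hdiff x hx).hasDerivWithinAt
  have hnonneg : ∀ x, 0 ≤ G x := fun x => by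
    obtain ⟨y, hy, h⟩ := hGproj x
    rw [h, ← hG0]
    exact hGm hy.1
  refine ⟨G, hder, hgc.domRestrict.Icc_extend', hGm, hG0, fun x hx => ?_, hnonneg, fun x => ?_⟩
  · have hz : 0 < min x A := lt_min hx hA
    have hzA : min x A ≤ A := min_le_right _ _
    obtain ⟨s, hs, hs'⟩ := exists_hasDerivAt_eq_slope f G hz
      (hdiff.continuousOn.mono (Icc_subset_Icc_right hzA)) fun t ht =>
        (hder t ⟨ht.1.le, ht.2.le.trans hzA⟩).hasDerivAt
          (Icc_mem_nhds ht.1 (ht.2.trans_le hzA))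
    have hlt := hmono h0A ⟨hz.le, hzA⟩ hz
    have : 0 < G s := hs' ▸ div_pos (sub_pos.2 hlt) (by simpa using hz)
    exact this.trans_le (hGm (hs.2.le.trans (min_le_left _ _)))
  · obtain ⟨y, hy, h⟩ := hGproj x
    exact h ▸ hGm hy.2

lemma eqOn_integral_of_hasDerivWithinAt {A : ℝ} (hA : 0 < A) {f G : ℝ → ℝ} (hG : Continuous G)
    (hf : ∀ x ∈ Icc 0 A, HasDerivWithinAt f (G x) (Icc 0 A) x) (h0 : f 0 = 0) :
    EqOn f (fun x => ∫ t in (0:ℝ)..x, G t) (Icc 0 A) := fun x hx => by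
  have hd : ∀ y ∈ Icc 0 A, HasDerivWithinAt (fun x => f x - ∫ t in (0:ℝ)..x, G t) 0 (Icc 0 A) y :=
    fun y hy => by
      simpa using (hf y hy).fun_sub (hasDerivAt_integral_of_continuous hG y).hasDerivWithinAt
  have := constant_of_derivWithin_zero (fun y hy => (hd y hy).differentiableWithinAt)
    (fun y hy => (hd y ⟨hy.1, hy.2.le⟩).derivWithin
      (uniqueDiffOn_Icc hA y ⟨hy.1, hy.2.le⟩)) x hx
  simp only [h0, intervalIntegral.integral_same, sub_self] at this
  exact sub_eq_zero.1 this

/-- Lemma 4.1. -/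
theorem exists_close_graph_intrinsically_isometric
    (astar : ℝ) (hastar : 0 < astar) (f₁ : ℝ → ℝ)
    (hconv₁ : ConvexOn ℝ (Icc 0 astar) f₁)
    (hmono₁ : StrictMonoOn f₁ (Icc 0 astar))
    (hsm₁ : ContDiffOn ℝ 1 f₁ (Icc 0 astar))
    (h₁0 : f₁ 0 = 0) (h₁0' : derivWithin f₁ (Icc 0 astar) 0 = 0)
    (hseg : ∃ p q, IsMaximalSegmentOf (graphSet f₁ astar) p q)
    (hdense : graphSet f₁ astar ⊆ closure (maxSegUnion (graphSet f₁ astar)))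
    (hlim0 : ptE 0 0 ∈
      closure (leftEndpoints (graphSet f₁ astar) \ {ptE 0 0}))
    (hlima : ptE astar (f₁ astar) ∈
      closure (leftEndpoints (graphSet f₁ astar) \ {ptE astar (f₁ astar)})) :
    ∀ ε : ℝ, 0 < ε → ∃ f₂ : ℝ → ℝ,
      (∃ x ∈ Icc 0 astar, f₂ x ≠ f₁ x) ∧
      ConvexOn ℝ (Icc 0 astar) f₂ ∧
      StrictMonoOn f₂ (Icc 0 astar) ∧
      ContDiffOn ℝ 1 f₂ (Icc 0 astar) ∧
      (∀ x ∈ Icc 0 astar, |f₂ x - f₁ x| ≤ ε) ∧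
      f₂ 0 = 0 ∧ derivWithin f₂ (Icc 0 astar) 0 = 0 ∧
      f₂ astar = f₁ astar ∧
      derivWithin f₂ (Icc 0 astar) astar = derivWithin f₁ (Icc 0 astar) astar ∧
      ∃ φ ψ : ℝ → ℝ,
        Set.BijOn φ (Icc 0 astar) (Icc 0 astar) ∧
        ContDiffOn ℝ 1 φ (Icc 0 astar) ∧ ContDiffOn ℝ 1 ψ (Icc 0 astar) ∧
        (∀ x ∈ Icc 0 astar, ψ (φ x) = x) ∧
        (∀ x ∈ Icc 0 astar, φ (ψ x) = x) ∧
        (∀ x ∈ Icc 0 astar,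
          (∫ t in (0:ℝ)..(φ x),
            Real.sqrt (1 + (derivWithin f₁ (Icc 0 astar) t)^2)) =
          ∫ t in (0:ℝ)..x,
            Real.sqrt (1 + (derivWithin f₂ (Icc 0 astar) t)^2)) ∧
        ∃ F : EuclideanSpace ℝ (Fin 2) → EuclideanSpace ℝ (Fin 2),
          (∀ p : EuclideanSpace ℝ (Fin 2), F p = ptE (ψ (p 0)) (f₂ (ψ (p 0)))) ∧
          F '' graphSet f₁ astar = graphSet f₂ astar ∧
          (∀ p ∈ graphSet f₁ astar, ∀ q ∈ graphSet f₁ astar,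
            intrinsicDist (graphSet f₁ astar) p q =
              intrinsicDist (graphSet f₂ astar) (F p) (F q)) ∧
          ∀ p q : EuclideanSpace ℝ (Fin 2), p ≠ q →
            segment ℝ p q ⊆ graphSet f₁ astar →
            ∃ p' q' : EuclideanSpace ℝ (Fin 2),
              F '' segment ℝ p q = segment ℝ p' q' ∧
              segment ℝ p' q' ⊆ graphSet f₂ astar ∧
              dist p' q' = dist p q := by
  intro ε hε
  set I := Icc 0 astar with hI
  obtain ⟨G, hder, hG, hGm, hG0, hGpos, hGnn, hGle⟩ :=
    exists_slope_extension hastar hconv₁ hmono₁ hsm₁ h₁0'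
  set f : ℝ → ℝ := fun x => ∫ t in (0:ℝ)..x, G t with hf
  have hff : EqOn f₁ f I := eqOn_integral_of_hasDerivWithinAt hastar hG hder h₁0
  have hgraph : graphSet f₁ astar = graphSet f astar :=
    image_congr fun x hx => by rw [hff hx]
  obtain ⟨f₂, G₂, H, X, hX, hX0, hXA, h₂0, h₂A, hG₂m, hG₂0, hG₂A, hG₂pos, hclose, hne⟩ :=
    exists_isSlopeChange hastar (hasDerivAt_integral_of_continuous hG)
      intervalIntegral.integral_same hG hGm hG0 hGpos hGnn hGle hε
  have h0I : (0:ℝ) ∈ I := left_mem_Icc.2 hastar.le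
  have hAI : astar ∈ I := right_mem_Icc.2 hastar.le
  have hu : UniqueDiffOn ℝ I := uniqueDiffOn_Icc hastar
  have hd₁ : EqOn (derivWithin f₁ I) G I := fun x hx => (hder x hx).derivWithin (hu x hx)
  have hd₂ : EqOn (derivWithin f₂ I) G₂ I := fun x hx =>
    (hX.hasDerivAt_right x).hasDerivWithinAt.derivWithin (hu x hx)
  have hdiff₂ : Differentiable ℝ f₂ := fun x => (hX.hasDerivAt_right x).differentiableAt
  have hderiv₂ : deriv f₂ = G₂ := funext fun x => (hX.hasDerivAt_right x).deriv
  have hmaps : MapsTo X I I := fun x hx => (hX.mem_Icc_iff hX0 hXA).2 hx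
  have hmaps' : MapsTo X.symm I I := fun x hx =>
    (hX.mem_Icc_iff hX0 hXA).1 (by rwa [X.apply_symm_apply])
  have harc : ∀ {g k : ℝ → ℝ}, EqOn g k I → ∀ x ∈ I,
      ∫ t in (0:ℝ)..x, √(1 + g t ^ 2) = arcLength k x := fun hgk x hx =>
    intervalIntegral.integral_congr fun t ht => by
      rw [uIcc_of_le hx.1] at ht
      simp only [hgk ⟨ht.1, ht.2.trans hx.2⟩]
  refine ⟨f₂, ?_, ?_, ?_, ?_, fun x hx => hff hx ▸ hclose x hx, h₂0, (hd₂ h0I).trans hG₂0,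
    h₂A.trans (hff hAI).symm, ?_, X.symm, X, ⟨hmaps', X.symm.injective.injOn, ?_⟩,
    hX.contDiff_symm.contDiffOn, hX.contDiff.contDiffOn, fun x _ => X.apply_symm_apply x,
    fun x _ => X.symm_apply_apply x, fun x hx => ?_, IsSlopeChange.graphMap f₂ X, fun p => rfl, ?_,
    fun p hp q hq => ?_, fun p q hpq hsegpq => ?_⟩
  · obtain ⟨x, hx, hxne⟩ := hX.exists_ne hastar hX0 hXA hne
    exact ⟨x, hx, hff hx ▸ hxne⟩
  · exact MonotoneOn.convexOn_of_deriv (convex_Icc _ _) hdiff₂.continuous.continuousOn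
      hdiff₂.differentiableOn (hderiv₂ ▸ hG₂m.monotoneOn _)
  · refine strictMonoOn_of_deriv_pos (convex_Icc _ _) hdiff₂.continuous.continuousOn fun x hx => ?_
    rw [interior_Icc] at hx
    exact hderiv₂ ▸ hG₂pos x hx.1
  · exact (contDiff_one_iff_deriv.2 ⟨hdiff₂, hderiv₂ ▸ hX.continuous_right⟩).contDiffOn
  · rw [hd₂ hAI, hd₁ hAI, hG₂A]
  · exact fun x hx => ⟨X x, hmaps hx, X.symm_apply_apply x⟩
  · rw [harc hd₁ _ (hmaps' hx), harc hd₂ _ hx, ← hX.arcLength_eq hX0, X.apply_symm_apply]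
  · rw [hgraph]; exact hX.image_graphSet hX0 hXA
  · rw [hgraph] at hp hq ⊢
    exact hX.intrinsicDist_eq hX0 hXA hp hq
  · rw [hgraph] at hsegpq
    obtain ⟨himage, hdist⟩ := hX.image_segment hpq hsegpq
    exact ⟨_, _, himage, himage ▸ hX.image_graphSet hX0 hXA ▸ image_mono hsegpq, hdist⟩

end
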